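/- Let G = (V,E) be a finite simple graph with m = |E| edges and arboricity at most α. Then ∑_{e∈E} deg(e) ≤ 2mα, where for an edge e = {u,v}, deg(e) = min(deg(u), deg(v)) is the smaller of the degrees of its two endpoints. -/

import Mathlib

open Finset SimpleGraph

/-- `G` has arboricity at most `a`: its edge set can be partitioned into `a` forests. -/
def ArboricityLE {V : Type*} (G : SimpleGraph V) (a : ℕ) : Prop :=
  ∃ F : Fin a → SimpleGraph V,
    (∀ i, F i ≤ G) ∧ (∀ i, (F i).IsAcyclic) ∧
      ∀ e ∈ G.edgeSet, ∃! i, e ∈ (F i).edgeSet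

/-- The arboricity of `G`: the minimum number of forests into which the edge set of `G`
can be partitioned. -/
noncomputable def arboricity {V : Type*} (G : SimpleGraph V) : ℕ :=
  sInf {a | ArboricityLE G a}

/-- The degree of an edge `e = {u, v}`: the smaller of the degrees of its two endpoints. -/
def edgeDeg {V : Type*} [Fintype V] [DecidableEq V]
    (G : SimpleGraph V) [DecidableRel G.Adj] (e : Sym2 V) : ℕ :=
  Sym2.lift ⟨fun u v => min (G.degree u) (G.degree v), fun u v => by simp [min_comm]⟩ e

theorem SimpleGraph.IsAcyclic.exists_parent {V : Type*} {F : SimpleGraph V} (hF : F.IsAcyclic) :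
    ∃ g : V → V, ∀ ⦃u v⦄, F.Adj u v → v = g u ∨ u = g v := by
  classical
  have hroot (u : V) : F.Reachable u (F.connectedComponentMk u).out :=
    ConnectedComponent.exact (Quot.out_eq _).symm
  choose p hp using fun u => (hroot u).exists_isPath
  refine ⟨fun u => (p u).snd, fun u v huv => ?_⟩
  by_cases hv : v ∈ (p u).support
  · exact .inl (hF.eq_snd_of_adj_start (hp u) huv hv)
  · right
    have hc : F.connectedComponentMk v = F.connectedComponentMk u :=
      ConnectedComponent.sound huv.symm.reachable
    have key : ∀ r (q : F.Walk v r), q.IsPath → r = (F.connectedComponentMk u).out →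
        u = q.snd := by
      rintro r q hq rfl
      refine hF.eq_snd_of_adj_start hq huv.symm ?_
      simpa using hF.mem_support_of_ne_mem_support_of_adj_of_isPath hq.reverse (hp u).reverse
        huv.symm (by simpa using hv)
    exact key _ (p v) (hp v) (by rw [hc])

theorem SimpleGraph.isAcyclic_edge {V : Type*} (u v : V) : (edge u v).IsAcyclic := by
  rw [← bot_sup_eq (edge u v), isAcyclic_sup_fromEdgeSet_iff]
  exact ⟨isAcyclic_bot, fun h => .inl (by simpa using h)⟩

theorem exists_arboricityLE {V : Type*} [Finite V] (G : SimpleGraph V) :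
    ∃ a, ArboricityLE G a := by
  obtain ⟨a, ⟨φ⟩⟩ := Finite.exists_equiv_fin G.edgeSet
  refine ⟨a, fun i => fromEdgeSet {(φ.symm i : Sym2 V)}, fun i => ?_, fun i => ?_,
    fun e he => ⟨φ ⟨e, he⟩, ?_, fun i hi => ?_⟩⟩
  · exact (fromEdgeSet_mono (Set.singleton_subset_iff.mpr (φ.symm i).2)).trans
      G.fromEdgeSet_edgeSet.le
  · exact Sym2.ind (f := fun e => (fromEdgeSet {e}).IsAcyclic) isAcyclic_edge (φ.symm i : Sym2 V)
  · simpa using G.not_isDiag_of_mem_edgeSet he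
  · have : e = φ.symm i := by
      simp only [edgeSet_fromEdgeSet] at hi
      exact hi.1
    simp [this]

theorem arboricityLE_arboricity {V : Type*} [Finite V] (G : SimpleGraph V) :
    ArboricityLE G (arboricity G) :=
  Nat.sInf_mem (exists_arboricityLE G)

/-- In a finite simple graph with `m` edges and arboricity at most `α`,
`∑_{e ∈ E} deg(e) ≤ 2mα`, where `deg(e)` is the smaller endpoint degree of `e`. -/
theorem sum_edgeDeg_le {V : Type*} [Fintype V] [DecidableEq V]
    (G : SimpleGraph V) [DecidableRel G.Adj] (α : ℕ) (hα : arboricity G ≤ α) :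
    ∑ e ∈ G.edgeFinset, edgeDeg G e ≤ 2 * G.edgeFinset.card * α := by
  obtain ⟨F, -, hF, hcover⟩ := arboricityLE_arboricity G
  choose g hg using fun i => (hF i).exists_parent
  have hsub : G.edgeFinset ⊆
      univ.image fun x : Fin (arboricity G) × V => s(x.2, g x.1 x.2) := by
    rintro ⟨u, v⟩ he
    obtain ⟨i, hi, -⟩ := hcover _ (mem_edgeFinset.mp he)
    refine mem_image.mpr ?_
    rcases hg i hi with h | h
    · exact ⟨(i, u), mem_univ _, by simp [← h]⟩
    · exact ⟨(i, v), mem_univ _, by simp [← h, Sym2.eq_swap]⟩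
  calc ∑ e ∈ G.edgeFinset, edgeDeg G e
      ≤ ∑ e ∈ univ.image fun x : Fin (arboricity G) × V => s(x.2, g x.1 x.2), edgeDeg G e :=
        sum_le_sum_of_subset hsub
    _ ≤ ∑ x : Fin (arboricity G) × V, edgeDeg G s(x.2, g x.1 x.2) :=
        sum_image_le_of_nonneg fun _ _ => Nat.zero_le _
    _ ≤ ∑ x : Fin (arboricity G) × V, G.degree x.2 :=
        sum_le_sum fun _ _ => min_le_left _ _
    _ = 2 * G.edgeFinset.card * arboricity G := by
        simp [Fintype.sum_prod_type, sum_degrees_eq_twice_card_edges, mul_comm]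
    _ ≤ 2 * G.edgeFinset.card * α := Nat.mul_le_mul_left _ hα
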